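/- Let ε > 0 and suppose λ > 0 is such that ∫_{[0,1]²} |Pφ|² ≥ λ · ∫_{[0,1]²} |φ|² for every smooth φ : ℝ² → ℂ that is 1-periodic in both variables. Then for all smooth u, v : ℝ × ℝ² → ℂ that are 1-periodic in x₂ and in x₃ and satisfy v(0,z) = v(ε,z) = 0 for all z ∈ ℝ², one has ∫_{[0,ε]×[0,1]²} ( |u|² + |v|² ) ≤ max(1/λ, ε²/2) · ∫_{[0,ε]×[0,1]²} ( |∂₁u − i·P†v|² + |∂₁v + i·Pu|² ). In particular, if D(u,v) = 0 identically on [0,ε] × ℝ², then u ≡ 0 and v ≡ 0 on [0,ε] × ℝ². (Flat-model version of the L²-estimate ‖V‖ ≤ C(λ)‖𝒟V‖ and of the triviality of ker 𝒟₋.) -/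

import Mathlib

open MeasureTheory

noncomputable section

/-- Points of the 3-dimensional model `A_ε = [0,ε] × T²`. -/
abbrev Pt : Type := ℝ × (ℝ × ℝ)

/-- Partial derivative in the second coordinate (`x₂`). -/
def d2 (φ : ℝ × ℝ → ℂ) (z : ℝ × ℝ) : ℂ := fderiv ℝ φ z (1, 0)

/-- Partial derivative in the third coordinate (`x₃`). -/
def d3 (φ : ℝ × ℝ → ℂ) (z : ℝ × ℝ) : ℂ := fderiv ℝ φ z (0, 1)

/-- The twisted Cauchy–Riemann operator `Pφ = ∂₂φ + i ∂₃φ + a·φ`. -/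
def POp (a φ : ℝ × ℝ → ℂ) (z : ℝ × ℝ) : ℂ :=
  d2 φ z + Complex.I * d3 φ z + a z * φ z

/-- The formal adjoint `P†φ = −∂₂φ + i ∂₃φ + conj(a)·φ`. -/
def PAdj (a φ : ℝ × ℝ → ℂ) (z : ℝ × ℝ) : ℂ :=
  -(d2 φ z) + Complex.I * d3 φ z + (starRingEnd ℂ) (a z) * φ z

/-- Partial derivative in the first coordinate (`x₁`). -/
def d1 (u : Pt → ℂ) (p : Pt) : ℂ := fderiv ℝ u p (1, 0, 0)

/-- Slice-wise action of `P` on functions of `(x₁, z)`. -/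
def POpS (a : ℝ × ℝ → ℂ) (u : Pt → ℂ) (p : Pt) : ℂ := POp a (fun z => u (p.1, z)) p.2

/-- Slice-wise action of `P†` on functions of `(x₁, z)`. -/
def PAdjS (a : ℝ × ℝ → ℂ) (u : Pt → ℂ) (p : Pt) : ℂ := PAdj a (fun z => u (p.1, z)) p.2

/-- `1`-periodicity in both variables of `ℝ²`. -/
def Per2 (φ : ℝ × ℝ → ℂ) : Prop :=
  (∀ x y : ℝ, φ (x + 1, y) = φ (x, y)) ∧ (∀ x y : ℝ, φ (x, y + 1) = φ (x, y))

/-- `1`-periodicity in `x₂` and `x₃` for functions on `ℝ × ℝ²`. -/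
def Per23 (u : Pt → ℂ) : Prop := ∀ t : ℝ, Per2 (fun z => u (t, z))

/-- The fundamental domain `[0,1]²` of the torus. -/
def T2 : Set (ℝ × ℝ) := Set.Icc (0:ℝ) 1 ×ˢ Set.Icc (0:ℝ) 1

/-- The thin domain `A_ε = [0,ε] × [0,1]²`. -/
def Aeps (ε : ℝ) : Set Pt := Set.Icc (0:ℝ) ε ×ˢ T2

/-- The directional derivative of a smooth function is smooth. -/
lemma contDiff_fderiv_apply_const {E F : Type*} [NormedAddCommGroup E] [NormedSpace ℝ E]
    [NormedAddCommGroup F] [NormedSpace ℝ F] {f : E → F}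
    (hf : ContDiff ℝ (⊤ : ℕ∞) f) (e : E) :
    ContDiff ℝ (⊤ : ℕ∞) (fun p => fderiv ℝ f p e) :=
  (hf.fderiv_right (by simp)).clm_apply contDiff_const

lemma isCompact_T2 : IsCompact T2 := isCompact_Icc.prod isCompact_Icc

lemma isCompact_Aeps (ε : ℝ) : IsCompact (Aeps ε) := isCompact_Icc.prod isCompact_T2

/-- The chain rule for a slice `s ↦ (s, y)`. -/
lemma hasDerivAt_slice_left {E : Type*} [NormedAddCommGroup E] [NormedSpace ℝ E]
    {F : ℝ × E → ℂ} {x : ℝ} {y : E} (hF : DifferentiableAt ℝ F (x, y)) :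
    HasDerivAt (fun s => F (s, y)) (fderiv ℝ F (x, y) (1, 0)) x :=
  hF.hasFDerivAt.comp_hasDerivAt (f := fun s : ℝ => (s, y)) x
    ((hasDerivAt_id x).prodMk (hasDerivAt_const x y))

/-- The chain rule for a slice `s ↦ (x, s)`. -/
lemma hasDerivAt_slice_right {E : Type*} [NormedAddCommGroup E] [NormedSpace ℝ E]
    {F : E × ℝ → ℂ} {x : E} {y : ℝ} (hF : DifferentiableAt ℝ F (x, y)) :
    HasDerivAt (fun s => F (x, s)) (fderiv ℝ F (x, y) (0, 1)) y :=
  hF.hasFDerivAt.comp_hasDerivAt (f := fun s : ℝ => (x, s)) y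
    ((hasDerivAt_const y x).prodMk (hasDerivAt_id y))

lemma fderiv_slice {u : Pt → ℂ} (hu : Differentiable ℝ u) (t : ℝ) (z e : ℝ × ℝ) :
    fderiv ℝ (fun z => u (t, z)) z e = fderiv ℝ u (t, z) (0, e) := by
  have h : HasFDerivAt (fun z => u (t, z))
      ((fderiv ℝ u (t, z)).comp (ContinuousLinearMap.inr ℝ ℝ (ℝ × ℝ))) z :=
    (hu (t, z)).hasFDerivAt.comp z (hasFDerivAt_prodMk_right t z)
  rw [h.fderiv]
  simp

lemma contDiff_slice {u : Pt → ℂ} (hu : ContDiff ℝ (⊤ : ℕ∞) u) (t : ℝ) :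
    ContDiff ℝ (⊤ : ℕ∞) (fun z => u (t, z)) :=
  hu.comp (contDiff_const.prodMk contDiff_id)

/-- The integral over `[0,l]` of the derivative of a function with equal end values vanishes. -/
lemma setIntegral_deriv_eq_zero {f f' : ℝ → ℂ} {l : ℝ} (hl : 0 ≤ l)
    (hf : ∀ x, HasDerivAt f (f' x) x) (hf' : Continuous f') (h : f l = f 0) :
    ∫ x in Set.Icc 0 l, f' x = 0 := by
  rw [integral_Icc_eq_integral_Ioc, ← intervalIntegral.integral_of_le hl,
    intervalIntegral.integral_eq_sub_of_hasDerivAt (fun x _ => hf x)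
      (hf'.intervalIntegrable _ _), h, sub_self]

/-- A smooth doubly periodic function has an `x₂`-derivative of mean zero. -/
lemma setIntegral_T2_d2 {φ : ℝ × ℝ → ℂ} (hφ : ContDiff ℝ (⊤ : ℕ∞) φ) (hp : Per2 φ) :
    ∫ z in T2, d2 φ z = 0 := by
  have hc : Continuous (d2 φ) := (contDiff_fderiv_apply_const hφ (1, 0)).continuous
  have hi : IntegrableOn (d2 φ) T2 := hc.continuousOn.integrableOn_compact isCompact_T2
  rw [T2, Measure.volume_eq_prod] at *
  rw [IntegrableOn, ← Measure.prod_restrict] at hi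
  rw [← Measure.prod_restrict, integral_prod_symm _ hi]
  refine (integral_congr_ae (Filter.Eventually.of_forall fun y => ?_)).trans (integral_zero _ _)
  exact setIntegral_deriv_eq_zero zero_le_one
    (fun x => hasDerivAt_slice_left (hφ.differentiable (by simp) (x, y)))
    (hc.comp (by fun_prop : Continuous fun x : ℝ => (x, y))) (by simpa using hp.1 0 y)

/-- A smooth doubly periodic function has an `x₃`-derivative of mean zero. -/
lemma setIntegral_T2_d3 {φ : ℝ × ℝ → ℂ} (hφ : ContDiff ℝ (⊤ : ℕ∞) φ) (hp : Per2 φ) :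
    ∫ z in T2, d3 φ z = 0 := by
  have hc : Continuous (d3 φ) := (contDiff_fderiv_apply_const hφ (0, 1)).continuous
  have hi : IntegrableOn (d3 φ) T2 := hc.continuousOn.integrableOn_compact isCompact_T2
  rw [T2, Measure.volume_eq_prod] at *
  rw [setIntegral_prod _ hi]
  refine (integral_congr_ae (Filter.Eventually.of_forall fun x => ?_)).trans (integral_zero _ _)
  exact setIntegral_deriv_eq_zero zero_le_one
    (fun y => hasDerivAt_slice_right (hφ.differentiable (by simp) (x, y)))
    (hc.comp (by fun_prop : Continuous fun y : ℝ => (x, y))) (by simpa using hp.2 x 0)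

lemma integrableOn_Aeps {E : Type*} [NormedAddCommGroup E] {f : Pt → E} (hf : Continuous f)
    (ε : ℝ) : IntegrableOn f (Aeps ε) :=
  hf.continuousOn.integrableOn_compact (isCompact_Aeps ε)

/-- Fubini on `A_ε`, torus variables inside. -/
lemma setIntegral_Aeps {E : Type*} [NormedAddCommGroup E] [NormedSpace ℝ E] {f : Pt → E}
    (hf : Continuous f) (ε : ℝ) :
    ∫ p in Aeps ε, f p = ∫ t in Set.Icc 0 ε, ∫ z in T2, f (t, z) := by
  have hi := integrableOn_Aeps hf ε
  rw [Aeps, Measure.volume_eq_prod] at *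
  exact setIntegral_prod _ hi

/-- Fubini on `A_ε`, normal variable inside. -/
lemma setIntegral_Aeps_symm {E : Type*} [NormedAddCommGroup E] [NormedSpace ℝ E] {f : Pt → E}
    (hf : Continuous f) (ε : ℝ) :
    ∫ p in Aeps ε, f p = ∫ z in T2, ∫ t in Set.Icc 0 ε, f (t, z) := by
  have hi := integrableOn_Aeps hf ε
  rw [Aeps, Measure.volume_eq_prod] at *
  rw [IntegrableOn, ← Measure.prod_restrict] at hi
  rw [← Measure.prod_restrict, integral_prod_symm _ hi]

lemma setIntegral_Aeps_d1 {F : Pt → ℂ} (hF : ContDiff ℝ (⊤ : ℕ∞) F) {ε : ℝ} (hε : 0 ≤ ε)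
    (hb : ∀ z, F (ε, z) = F (0, z)) : ∫ p in Aeps ε, fderiv ℝ F p (1, 0, 0) = 0 := by
  have hc := (contDiff_fderiv_apply_const hF (1, 0, 0)).continuous
  rw [setIntegral_Aeps_symm hc]
  refine (integral_congr_ae (Filter.Eventually.of_forall fun z => ?_)).trans (integral_zero _ _)
  exact setIntegral_deriv_eq_zero hε
    (fun t => hasDerivAt_slice_left (hF.differentiable (by simp) (t, z)))
    (hc.comp (by fun_prop : Continuous fun t : ℝ => (t, z))) (hb z)

lemma setIntegral_Aeps_d2 {F : Pt → ℂ} (hF : ContDiff ℝ (⊤ : ℕ∞) F) (ε : ℝ)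
    (hp : Per23 F) : ∫ p in Aeps ε, fderiv ℝ F p (0, 1, 0) = 0 := by
  rw [setIntegral_Aeps (contDiff_fderiv_apply_const hF (0, 1, 0)).continuous]
  refine (integral_congr_ae (Filter.Eventually.of_forall fun t => ?_)).trans (integral_zero _ _)
  simp_rw [← fderiv_slice (hF.differentiable (by simp))]
  exact setIntegral_T2_d2 (contDiff_slice hF t) (hp t)

lemma setIntegral_Aeps_d3 {F : Pt → ℂ} (hF : ContDiff ℝ (⊤ : ℕ∞) F) (ε : ℝ)
    (hp : Per23 F) : ∫ p in Aeps ε, fderiv ℝ F p (0, 0, 1) = 0 := by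
  rw [setIntegral_Aeps (contDiff_fderiv_apply_const hF (0, 0, 1)).continuous]
  refine (integral_congr_ae (Filter.Eventually.of_forall fun t => ?_)).trans (integral_zero _ _)
  simp_rw [← fderiv_slice (hF.differentiable (by simp))]
  exact setIntegral_T2_d3 (contDiff_slice hF t) (hp t)

/-- The `x₁`-derivative of a function periodic in `x₂` and `x₃` is periodic. -/
lemma Per23.fderiv_apply {u : Pt → ℂ} (hu : Differentiable ℝ u) (hp : Per23 u) :
    Per23 (fun p => fderiv ℝ u p (1, 0, 0)) := by
  intro t
  constructor <;> intro x y
  · refine (hasDerivAt_slice_left (hu (t, x + 1, y))).unique ?_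
    rw [show (fun s => u (s, x + 1, y)) = fun s => u (s, x, y) from funext fun s => (hp s).1 x y]
    exact hasDerivAt_slice_left (hu (t, x, y))
  · refine (hasDerivAt_slice_left (hu (t, x, y + 1))).unique ?_
    rw [show (fun s => u (s, x, y + 1)) = fun s => u (s, x, y) from funext fun s => (hp s).2 x y]
    exact hasDerivAt_slice_left (hu (t, x, y))

lemma Per2.mul {φ ψ : ℝ × ℝ → ℂ} (hφ : Per2 φ) (hψ : Per2 ψ) : Per2 (fun z => φ z * ψ z) :=
  ⟨fun x y => by simp only [hφ.1, hψ.1], fun x y => by simp only [hφ.2, hψ.2]⟩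

/-- Cauchy–Schwarz against the constant function on `[0,t]`. -/
lemma sq_integral_le_mul_integral_sq {g : ℝ → ℝ} (hg : Continuous g) {t : ℝ} (ht : 0 ≤ t) :
    (∫ x in (0:ℝ)..t, g x) ^ 2 ≤ t * ∫ x in (0:ℝ)..t, g x ^ 2 := by
  rcases ht.eq_or_lt with rfl | ht0
  · simp
  set S := ∫ x in (0:ℝ)..t, g x with hS
  set c := S / t with hcdef
  have key : 0 ≤ ∫ x in (0:ℝ)..t, (g x - c) ^ 2 :=
    intervalIntegral.integral_nonneg ht fun x _ => sq_nonneg _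
  have expand : ∫ x in (0:ℝ)..t, (g x - c) ^ 2
      = (∫ x in (0:ℝ)..t, g x ^ 2) - 2 * c * S + t * c ^ 2 := by
    have h : ∀ x, (g x - c) ^ 2 = g x ^ 2 - 2 * c * g x + c ^ 2 := fun x => by ring
    simp_rw [h]
    rw [intervalIntegral.integral_add (Continuous.intervalIntegrable (by fun_prop) _ _)
        (Continuous.intervalIntegrable (by fun_prop) _ _),
      intervalIntegral.integral_sub (Continuous.intervalIntegrable (by fun_prop) _ _)
        (Continuous.intervalIntegrable (by fun_prop) _ _),
      intervalIntegral.integral_const_mul, intervalIntegral.integral_const]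
    simp [hS]
  rw [expand] at key
  have hc : S = t * c := by rw [hcdef]; field_simp
  rw [hc] at key ⊢
  nlinarith [mul_nonneg ht key]

/-- One-dimensional Poincaré inequality for functions vanishing at `0`. -/
lemma poincare_Icc {w w' : ℝ → ℂ} {ε : ℝ} (hε : 0 ≤ ε) (hw : ∀ x, HasDerivAt w (w' x) x)
    (hw' : Continuous w') (h0 : w 0 = 0) :
    ∫ t in Set.Icc 0 ε, ‖w t‖ ^ 2 ≤ ε ^ 2 / 2 * ∫ t in Set.Icc 0 ε, ‖w' t‖ ^ 2 := by
  have hwc : Continuous w := continuous_iff_continuousAt.2 fun x => (hw x).continuousAt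
  simp_rw [integral_Icc_eq_integral_Ioc, ← intervalIntegral.integral_of_le hε]
  set G := ∫ t in (0:ℝ)..ε, ‖w' t‖ ^ 2
  have bound : ∀ t ∈ Set.Icc 0 ε, ‖w t‖ ^ 2 ≤ t * G := by
    intro t ht
    have hft : w t = ∫ x in (0:ℝ)..t, w' x := by
      rw [intervalIntegral.integral_eq_sub_of_hasDerivAt (fun x _ => hw x)
        (hw'.intervalIntegrable _ _), h0, sub_zero]
    calc ‖w t‖ ^ 2 ≤ (∫ x in (0:ℝ)..t, ‖w' x‖) ^ 2 := by
          rw [hft]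
          gcongr
          exact intervalIntegral.norm_integral_le_integral_norm ht.1
      _ ≤ t * ∫ x in (0:ℝ)..t, ‖w' x‖ ^ 2 := sq_integral_le_mul_integral_sq hw'.norm ht.1
      _ ≤ t * G := by
          refine mul_le_mul_of_nonneg_left ?_ ht.1
          exact intervalIntegral.integral_mono_interval le_rfl ht.1 ht.2
            (Filter.Eventually.of_forall fun x => sq_nonneg _)
            ((hw'.norm.pow 2).intervalIntegrable _ _)
  calc ∫ t in (0:ℝ)..ε, ‖w t‖ ^ 2 ≤ ∫ t in (0:ℝ)..ε, t * G :=
        intervalIntegral.integral_mono_on hε ((hwc.norm.pow 2).intervalIntegrable _ _)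
          (Continuous.intervalIntegrable (by fun_prop) _ _) bound
    _ = ε ^ 2 / 2 * G := by
        rw [intervalIntegral.integral_mul_const, integral_id]
        ring

/-- Poincaré inequality in the normal direction on `A_ε`. -/
lemma poincare_Aeps {v : Pt → ℂ} (hv : ContDiff ℝ (⊤ : ℕ∞) v) {ε : ℝ} (hε : 0 ≤ ε)
    (h0 : ∀ z, v (0, z) = 0) :
    ∫ p in Aeps ε, ‖v p‖ ^ 2 ≤ ε ^ 2 / 2 * ∫ p in Aeps ε, ‖d1 v p‖ ^ 2 := by
  have hc : Continuous (d1 v) := (contDiff_fderiv_apply_const hv (1, 0, 0)).continuous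
  have hvc := hv.continuous
  have inner : ∀ {f : Pt → ℝ}, Continuous f →
      Integrable (fun z => ∫ t in Set.Icc 0 ε, f (t, z)) (volume.restrict T2) := by
    intro f hf
    have hi := integrableOn_Aeps hf ε
    rw [Aeps, Measure.volume_eq_prod, IntegrableOn, ← Measure.prod_restrict] at hi
    exact hi.integral_prod_right
  rw [setIntegral_Aeps_symm (by fun_prop), setIntegral_Aeps_symm (by fun_prop),
    ← integral_const_mul]
  refine integral_mono (inner (f := fun p => ‖v p‖ ^ 2) (by fun_prop))
    ((inner (f := fun p => ‖d1 v p‖ ^ 2) (by fun_prop)).const_mul _) fun z => ?_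
  exact poincare_Icc hε
    (fun t => hasDerivAt_slice_left (hv.differentiable (by simp) (t, z)))
    (hc.comp (by fun_prop : Continuous fun t : ℝ => (t, z))) (h0 z)

lemma fderiv_mul_apply {f g : Pt → ℂ} (hf : Differentiable ℝ f) (hg : Differentiable ℝ g)
    (p e : Pt) : fderiv ℝ (fun p => f p * g p) p e
      = f p * fderiv ℝ g p e + fderiv ℝ f p e * g p := by
  rw [fderiv_fun_mul (hf p) (hg p)]
  simp [mul_comm]

lemma fderiv_conj_apply {v : Pt → ℂ} (hv : Differentiable ℝ v) (p e : Pt) :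
    fderiv ℝ (fun p => (starRingEnd ℂ) (v p)) p e = (starRingEnd ℂ) (fderiv ℝ v p e) := by
  have h : HasFDerivAt (fun p => (starRingEnd ℂ) (v p))
      ((Complex.conjCLE : ℂ →L[ℝ] ℂ).comp (fderiv ℝ v p)) p :=
    (Complex.conjCLE : ℂ →L[ℝ] ℂ).hasFDerivAt.comp p (hv p).hasFDerivAt
  rw [h.fderiv]
  simp

/-- Second directional derivatives of a smooth function commute. -/
lemma fderiv_fderiv_apply_comm {u : Pt → ℂ} (hu : ContDiff ℝ (⊤ : ℕ∞) u) (p e e' : Pt) :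
    fderiv ℝ (fun q => fderiv ℝ u q e) p e' = fderiv ℝ (fun q => fderiv ℝ u q e') p e := by
  have hd : DifferentiableAt ℝ (fderiv ℝ u) p :=
    (hu.fderiv_right (m := (⊤ : ℕ∞)) (by simp)).differentiable (by simp) p
  rw [fderiv_clm_apply hd (differentiableAt_const _),
    fderiv_clm_apply hd (differentiableAt_const _)]
  have hs : IsSymmSndFDerivAt ℝ u p := hu.contDiffAt.isSymmSndFDerivAt (by
    rw [minSmoothness_of_isRCLikeNormedField]
    exact WithTop.coe_le_coe.2 (le_top : (2 : ℕ∞) ≤ ⊤))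
  simpa using hs e' e

/-- The algebraic identity behind the vanishing of the cross terms. -/
lemma cross_term_identity (a u u1 u2 u3 u12 u13 v v1 v2 v3 : ℂ) :
    ‖u1 - Complex.I * (-v2 + Complex.I * v3 + (starRingEnd ℂ) a * v)‖ ^ 2 +
        ‖v1 + Complex.I * (u2 + Complex.I * u3 + a * u)‖ ^ 2 =
      ‖u1‖ ^ 2 + ‖-v2 + Complex.I * v3 + (starRingEnd ℂ) a * v‖ ^ 2 +
        ‖v1‖ ^ 2 + ‖u2 + Complex.I * u3 + a * u‖ ^ 2 +
      2 * ((Complex.I * u2 - u3 + Complex.I * a * u) * (starRingEnd ℂ) v1 +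
          (Complex.I * u12 - u13 + Complex.I * a * u1) * (starRingEnd ℂ) v +
        -Complex.I * (u1 * (starRingEnd ℂ) v2 + u12 * (starRingEnd ℂ) v) +
        (u1 * (starRingEnd ℂ) v3 + u13 * (starRingEnd ℂ) v)).re := by
  simp only [Complex.sq_norm, Complex.normSq_apply, Complex.add_re, Complex.add_im,
    Complex.sub_re, Complex.sub_im, Complex.mul_re, Complex.mul_im, Complex.neg_re,
    Complex.neg_im, Complex.I_re, Complex.I_im, Complex.conj_re, Complex.conj_im]
  ring

lemma POpS_eq {a : ℝ × ℝ → ℂ} {u : Pt → ℂ} (hu : Differentiable ℝ u) (p : Pt) :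
    POpS a u p = fderiv ℝ u p (0, 1, 0) + Complex.I * fderiv ℝ u p (0, 0, 1)
      + a p.2 * u p := by
  simp only [POpS, POp, d2, d3, fderiv_slice hu]

lemma PAdjS_eq {a : ℝ × ℝ → ℂ} {v : Pt → ℂ} (hv : Differentiable ℝ v) (p : Pt) :
    PAdjS a v p = -fderiv ℝ v p (0, 1, 0) + Complex.I * fderiv ℝ v p (0, 0, 1)
      + (starRingEnd ℂ) (a p.2) * v p := by
  simp only [PAdjS, PAdj, d2, d3, fderiv_slice hv]

lemma continuous_POpS {a : ℝ × ℝ → ℂ} (ha : Continuous a) {u : Pt → ℂ}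
    (hu : ContDiff ℝ (⊤ : ℕ∞) u) : Continuous (POpS a u) := by
  have h2 := (contDiff_fderiv_apply_const hu (0, 1, 0)).continuous
  have h3 := (contDiff_fderiv_apply_const hu (0, 0, 1)).continuous
  have h := hu.continuous
  rw [funext (POpS_eq (a := a) (hu.differentiable (by simp)))]
  fun_prop

lemma continuous_PAdjS {a : ℝ × ℝ → ℂ} (ha : Continuous a) {v : Pt → ℂ}
    (hv : ContDiff ℝ (⊤ : ℕ∞) v) : Continuous (PAdjS a v) := by
  have h2 := (contDiff_fderiv_apply_const hv (0, 1, 0)).continuous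
  have h3 := (contDiff_fderiv_apply_const hv (0, 0, 1)).continuous
  have h := hv.continuous
  rw [funext (PAdjS_eq (a := a) (hv.differentiable (by simp)))]
  have := Complex.continuous_conj
  fun_prop

/-- The Weitzenböck-type identity: for `v` vanishing on the boundary the cross terms of
`‖D(u,v)‖²` integrate to zero. -/
lemma setIntegral_norm_sq_dirac {ε : ℝ} (hε : 0 ≤ ε) {a : ℝ × ℝ → ℂ}
    (ha : ContDiff ℝ (⊤ : ℕ∞) a) {u v : Pt → ℂ} (hu : ContDiff ℝ (⊤ : ℕ∞) u)
    (hv : ContDiff ℝ (⊤ : ℕ∞) v) (hup : Per23 u) (hvp : Per23 v)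
    (hbv : ∀ z : ℝ × ℝ, v (0, z) = 0 ∧ v (ε, z) = 0) :
    ∫ p in Aeps ε, (‖d1 u p - Complex.I * PAdjS a v p‖ ^ 2 +
        ‖d1 v p + Complex.I * POpS a u p‖ ^ 2) =
      ∫ p in Aeps ε, (‖d1 u p‖ ^ 2 + ‖PAdjS a v p‖ ^ 2 + ‖d1 v p‖ ^ 2 + ‖POpS a u p‖ ^ 2) := by
  set w : Pt → ℂ := fun p => (starRingEnd ℂ) (v p) with hw
  have hvd : Differentiable ℝ v := hv.differentiable (by simp)
  have hud : Differentiable ℝ u := hu.differentiable (by simp)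
  have hwc : ContDiff ℝ (⊤ : ℕ∞) w := (Complex.conjCLE : ℂ →L[ℝ] ℂ).contDiff.comp hv
  have hwp : Per23 w := fun t =>
    ⟨fun x y => congrArg (starRingEnd ℂ) ((hvp t).1 x y),
      fun x y => congrArg (starRingEnd ℂ) ((hvp t).2 x y)⟩
  have hu1 := contDiff_fderiv_apply_const hu (1, 0, 0)
  have hu2 := contDiff_fderiv_apply_const hu (0, 1, 0)
  have hu3 := contDiff_fderiv_apply_const hu (0, 0, 1)
  have ha' : ContDiff ℝ (⊤ : ℕ∞) (fun p : Pt => a p.2) := ha.comp contDiff_snd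
  set f : Pt → ℂ := fun p => Complex.I * fderiv ℝ u p (0, 1, 0) - fderiv ℝ u p (0, 0, 1)
    + Complex.I * a p.2 * u p
  have hf : ContDiff ℝ (⊤ : ℕ∞) f := by fun_prop
  set F1 : Pt → ℂ := fun p => f p * w p
  set F2 : Pt → ℂ := fun p => fderiv ℝ u p (1, 0, 0) * w p
  have hF1 : ContDiff ℝ (⊤ : ℕ∞) F1 := hf.mul hwc
  have hF2 : ContDiff ℝ (⊤ : ℕ∞) F2 := hu1.mul hwc
  have hF2p : Per23 F2 := fun t => (hup.fderiv_apply hud t).mul (hwp t)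
  have c1 := (contDiff_fderiv_apply_const hF1 (1, 0, 0)).continuous
  have c2 := (contDiff_fderiv_apply_const hF2 (0, 1, 0)).continuous
  have c3 := (contDiff_fderiv_apply_const hF2 (0, 0, 1)).continuous
  have i1 := setIntegral_Aeps_d1 hF1 hε (fun z => by simp [F1, hw, hbv z])
  have i2 := setIntegral_Aeps_d2 hF2 ε hF2p
  have i3 := setIntegral_Aeps_d3 hF2 ε hF2p
  have hdf : ∀ p, fderiv ℝ f p (1, 0, 0) =
      Complex.I * fderiv ℝ (fun q => fderiv ℝ u q (1, 0, 0)) p (0, 1, 0)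
      - fderiv ℝ (fun q => fderiv ℝ u q (1, 0, 0)) p (0, 0, 1)
      + Complex.I * a p.2 * fderiv ℝ u p (1, 0, 0) := by
    intro p
    have hI : HasFDerivAt (fun _ : Pt => Complex.I) (0 : Pt →L[ℝ] ℂ) p := hasFDerivAt_const _ _
    have h2 := (hu2.differentiable (by simp) p).hasFDerivAt
    have h3 := (hu3.differentiable (by simp) p).hasFDerivAt
    have h4 : HasFDerivAt (fun q : Pt => a q.2)
        ((fderiv ℝ a p.2).comp (ContinuousLinearMap.snd ℝ ℝ (ℝ × ℝ))) p :=
      (ha.differentiable (by simp) p.2).hasFDerivAt.comp p hasFDerivAt_snd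
    have h := ((hI.mul h2).sub h3).add ((hI.mul h4).mul (hud p).hasFDerivAt)
    rw [fderiv_fderiv_apply_comm hu p (1, 0, 0) (0, 1, 0),
      fderiv_fderiv_apply_comm hu p (1, 0, 0) (0, 0, 1)]
    refine (congrArg (fun L : Pt →L[ℝ] ℂ => L (1, 0, 0)) h.fderiv).trans ?_
    simp [show ((0 : ℝ), (0 : ℝ)) = 0 from rfl]
  have pointwise : ∀ p, ‖d1 u p - Complex.I * PAdjS a v p‖ ^ 2 +
        ‖d1 v p + Complex.I * POpS a u p‖ ^ 2 =
      (‖d1 u p‖ ^ 2 + ‖PAdjS a v p‖ ^ 2 + ‖d1 v p‖ ^ 2 + ‖POpS a u p‖ ^ 2) +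
      2 * (fderiv ℝ F1 p (1, 0, 0) + -Complex.I * fderiv ℝ F2 p (0, 1, 0)
        + fderiv ℝ F2 p (0, 0, 1)).re := by
    intro p
    have hwd : Differentiable ℝ w := hwc.differentiable (by simp)
    have hu1d := hu1.differentiable (by simp)
    rw [POpS_eq hud, PAdjS_eq hvd, fderiv_mul_apply (hf.differentiable (by simp)) hwd,
      fderiv_mul_apply hu1d hwd, fderiv_mul_apply hu1d hwd, hdf p,
      fderiv_conj_apply hvd, fderiv_conj_apply hvd, fderiv_conj_apply hvd]
    exact cross_term_identity _ _ _ _ _ _ _ _ _ _ _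
  have hPc := continuous_POpS ha.continuous hu
  have hPAc := continuous_PAdjS ha.continuous hv
  have hd1u : Continuous (d1 u) := hu1.continuous
  have hd1v : Continuous (d1 v) := (contDiff_fderiv_apply_const hv (1, 0, 0)).continuous
  have hcross : Continuous fun p => fderiv ℝ F1 p (1, 0, 0)
      + -Complex.I * fderiv ℝ F2 p (0, 1, 0) + fderiv ℝ F2 p (0, 0, 1) := by fun_prop
  have hzero : ∫ p in Aeps ε, (fderiv ℝ F1 p (1, 0, 0) + -Complex.I * fderiv ℝ F2 p (0, 1, 0)
        + fderiv ℝ F2 p (0, 0, 1)) = 0 := by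
    rw [integral_add (integrableOn_Aeps (by fun_prop) ε) (integrableOn_Aeps c3 ε),
      integral_add (integrableOn_Aeps c1 ε) (integrableOn_Aeps (by fun_prop) ε),
      integral_const_mul, i1, i2, i3]
    simp
  have hre : ∫ p in Aeps ε, (fderiv ℝ F1 p (1, 0, 0) + -Complex.I * fderiv ℝ F2 p (0, 1, 0)
        + fderiv ℝ F2 p (0, 0, 1)).re = 0 := by
    have h := integral_re (𝕜 := ℂ) (integrableOn_Aeps hcross ε)
    rw [hzero] at h
    simpa using h
  simp_rw [pointwise]
  rw [integral_add (integrableOn_Aeps (by fun_prop) ε)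
      ((integrableOn_Aeps (f := fun p => (fderiv ℝ F1 p (1, 0, 0)
        + -Complex.I * fderiv ℝ F2 p (0, 1, 0) + fderiv ℝ F2 p (0, 0, 1)).re)
        (Complex.continuous_re.comp hcross) ε).const_mul 2),
    integral_const_mul, hre, mul_zero, add_zero]

/-- A slice-wise lower bound for `P` integrates to a lower bound on `A_ε`. -/
lemma mul_setIntegral_Aeps_le {ε : ℝ} {a : ℝ × ℝ → ℂ} (ha : Continuous a) {lam : ℝ}
    (hP : ∀ φ : ℝ × ℝ → ℂ, ContDiff ℝ (⊤ : ℕ∞) φ → Per2 φ →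
      (∫ z in T2, ‖POp a φ z‖ ^ 2) ≥ lam * ∫ z in T2, ‖φ z‖ ^ 2)
    {u : Pt → ℂ} (hu : ContDiff ℝ (⊤ : ℕ∞) u) (hup : Per23 u) :
    lam * ∫ p in Aeps ε, ‖u p‖ ^ 2 ≤ ∫ p in Aeps ε, ‖POpS a u p‖ ^ 2 := by
  have hc := continuous_POpS ha hu
  have huc := hu.continuous
  have inner : ∀ {f : Pt → ℝ}, Continuous f →
      Integrable (fun t => ∫ z in T2, f (t, z)) (volume.restrict (Set.Icc 0 ε)) := by
    intro f hf
    have hi := integrableOn_Aeps hf ε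
    rw [Aeps, Measure.volume_eq_prod, IntegrableOn, ← Measure.prod_restrict] at hi
    exact hi.integral_prod_left
  rw [setIntegral_Aeps (by fun_prop), setIntegral_Aeps (by fun_prop), ← integral_const_mul]
  exact integral_mono ((inner (f := fun p => ‖u p‖ ^ 2) (by fun_prop)).const_mul _)
    (inner (f := fun p => ‖POpS a u p‖ ^ 2) (by fun_prop))
    fun t => hP _ (contDiff_slice hu t) (hup t)

/-- A doubly periodic function vanishing on the fundamental domain vanishes identically. -/
lemma Per2.eq_zero {φ : ℝ × ℝ → ℂ} (hp : Per2 φ) (h : ∀ z ∈ T2, φ z = 0) (z : ℝ × ℝ) :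
    φ z = 0 := by
  have hx : ∀ y, Function.Periodic (fun x => φ (x, y)) 1 := fun y x => hp.1 x y
  have hy : ∀ x, Function.Periodic (fun y => φ (x, y)) 1 := fun x y => hp.2 x y
  obtain ⟨x, y⟩ := z
  have e1 : φ (Int.fract x, y) = φ (x, y) := by
    simpa using (hx y).sub_int_mul_eq (x := x) ⌊x⌋
  have e2 : φ (Int.fract x, Int.fract y) = φ (Int.fract x, y) := by
    simpa using (hy (Int.fract x)).sub_int_mul_eq (x := y) ⌊y⌋
  rw [← e1, ← e2]
  exact h _ ⟨⟨Int.fract_nonneg x, (Int.fract_lt_one x).le⟩,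
    ⟨Int.fract_nonneg y, (Int.fract_lt_one y).le⟩⟩

/-- A nonnegative continuous function on `A_ε` with nonpositive integral vanishes there. -/
lemma eqOn_zero_of_setIntegral_Aeps_nonpos {ε : ℝ} (hε : 0 < ε) {f : Pt → ℝ}
    (hf : Continuous f) (h0 : ∀ p, 0 ≤ f p) (h : ∫ p in Aeps ε, f p ≤ 0) :
    ∀ p ∈ Aeps ε, f p = 0 := by
  have hz : ∫ p in Aeps ε, f p = 0 := le_antisymm h (integral_nonneg h0)
  rw [integral_eq_zero_iff_of_nonneg h0 (integrableOn_Aeps hf ε)] at hz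
  have hcl : closure (interior (Aeps ε)) = Aeps ε := by
    simp only [Aeps, T2, interior_prod_eq, closure_prod_eq, interior_Icc, closure_Ioo hε.ne,
      closure_Ioo zero_ne_one]
  exact Measure.eqOn_of_ae_eq hz hf.continuousOn continuousOn_const hcl.ge

/-- Flat-model version of the L²-estimate `‖V‖_{L²} ≤ C(λ)‖𝒟V‖_{L²}` and of the
triviality of `ker 𝒟₋`. -/
theorem L2_estimate_and_trivial_kernel
    (ε : ℝ) (hε : 0 < ε) (a : ℝ × ℝ → ℂ) (ha : ContDiff ℝ (⊤ : ℕ∞) a) (hap : Per2 a)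
    (lam : ℝ) (hlam : 0 < lam)
    (hP : ∀ φ : ℝ × ℝ → ℂ, ContDiff ℝ (⊤ : ℕ∞) φ → Per2 φ →
      (∫ z in T2, ‖POp a φ z‖ ^ 2) ≥ lam * ∫ z in T2, ‖φ z‖ ^ 2)
    (u v : Pt → ℂ) (hu : ContDiff ℝ (⊤ : ℕ∞) u) (hv : ContDiff ℝ (⊤ : ℕ∞) v)
    (hup : Per23 u) (hvp : Per23 v)
    (hbv : ∀ z : ℝ × ℝ, v (0, z) = 0 ∧ v (ε, z) = 0) :
    ((∫ p in Aeps ε, (‖u p‖ ^ 2 + ‖v p‖ ^ 2)) ≤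
      max (1 / lam) (ε ^ 2 / 2) *
        ∫ p in Aeps ε, (‖d1 u p - Complex.I * PAdjS a v p‖ ^ 2 +
          ‖d1 v p + Complex.I * POpS a u p‖ ^ 2)) ∧
    ((∀ p : Pt, p.1 ∈ Set.Icc (0:ℝ) ε →
        d1 u p - Complex.I * PAdjS a v p = 0 ∧ d1 v p + Complex.I * POpS a u p = 0) →
      ∀ p : Pt, p.1 ∈ Set.Icc (0:ℝ) ε → u p = 0 ∧ v p = 0) := by
  have hvc := hv.continuous
  have huc := hu.continuous
  have hest : (∫ p in Aeps ε, (‖u p‖ ^ 2 + ‖v p‖ ^ 2)) ≤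
      max (1 / lam) (ε ^ 2 / 2) *
        ∫ p in Aeps ε, (‖d1 u p - Complex.I * PAdjS a v p‖ ^ 2 +
          ‖d1 v p + Complex.I * POpS a u p‖ ^ 2) := by
    have hPc := continuous_POpS ha.continuous hu
    have hPAc := continuous_PAdjS ha.continuous hv
    have hd1u : Continuous (d1 u) := (contDiff_fderiv_apply_const hu (1, 0, 0)).continuous
    have hd1v : Continuous (d1 v) := (contDiff_fderiv_apply_const hv (1, 0, 0)).continuous
    rw [setIntegral_norm_sq_dirac hε.le ha hu hv hup hvp hbv,
      integral_add (integrableOn_Aeps (by fun_prop) ε) (integrableOn_Aeps (by fun_prop) ε),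
      integral_add (integrableOn_Aeps (by fun_prop) ε) (integrableOn_Aeps (by fun_prop) ε),
      integral_add (integrableOn_Aeps (by fun_prop) ε) (integrableOn_Aeps (by fun_prop) ε),
      integral_add (integrableOn_Aeps (by fun_prop) ε) (integrableOn_Aeps (by fun_prop) ε)]
    have hpv := poincare_Aeps hv hε.le fun z => (hbv z).1
    have hpu := mul_setIntegral_Aeps_le (ε := ε) ha.continuous hP hu hup
    have nonneg : ∀ f : Pt → ℂ, 0 ≤ ∫ p in Aeps ε, ‖f p‖ ^ 2 := fun f =>
      integral_nonneg fun p => sq_nonneg _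
    have n1 := nonneg (d1 u)
    have n2 := nonneg (PAdjS a v)
    have n3 := nonneg (d1 v)
    have n4 := nonneg (POpS a u)
    have hpu' : ∫ p in Aeps ε, ‖u p‖ ^ 2 ≤ 1 / lam * ∫ p in Aeps ε, ‖POpS a u p‖ ^ 2 := by
      rw [one_div_mul_eq_div, le_div_iff₀ hlam, mul_comm]
      exact hpu
    have m1 := mul_le_mul_of_nonneg_right (le_max_left (1 / lam) (ε ^ 2 / 2)) n4
    have m2 := mul_le_mul_of_nonneg_right (le_max_right (1 / lam) (ε ^ 2 / 2)) n3
    have m0 : 0 ≤ max (1 / lam) (ε ^ 2 / 2) := le_max_of_le_right (by positivity)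
    have m3 := mul_nonneg m0 n1
    have m4 := mul_nonneg m0 n2
    linarith
  refine ⟨hest, fun hD => ?_⟩
  have hrhs : ∫ p in Aeps ε, (‖d1 u p - Complex.I * PAdjS a v p‖ ^ 2 +
      ‖d1 v p + Complex.I * POpS a u p‖ ^ 2) = 0 := by
    refine setIntegral_eq_zero_of_forall_eq_zero fun p hp => ?_
    rw [(hD p hp.1).1, (hD p hp.1).2]
    simp
  rw [hrhs, mul_zero] at hest
  have hzero := eqOn_zero_of_setIntegral_Aeps_nonpos hε
    (by fun_prop : Continuous fun p => ‖u p‖ ^ 2 + ‖v p‖ ^ 2) (fun p => by positivity) hest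
  intro p hp
  have hz : ∀ z ∈ T2, ‖u (p.1, z)‖ ^ 2 + ‖v (p.1, z)‖ ^ 2 = 0 := fun z hz =>
    hzero (p.1, z) ⟨hp, hz⟩
  constructor
  · refine (hup p.1).eq_zero (fun z hzT => ?_) p.2
    have h := hz z hzT
    exact norm_eq_zero.1 (pow_eq_zero_iff two_ne_zero |>.1
      (by linarith [sq_nonneg ‖u (p.1, z)‖, sq_nonneg ‖v (p.1, z)‖]))
  · refine (hvp p.1).eq_zero (fun z hzT => ?_) p.2
    have h := hz z hzT
    exact norm_eq_zero.1 (pow_eq_zero_iff two_ne_zero |>.1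
      (by linarith [sq_nonneg ‖u (p.1, z)‖, sq_nonneg ‖v (p.1, z)‖]))
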